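/- Let N ≥ 3, θ ∈ (0, π/4], and α = 2cos(2θ)/√(1+sin²(2θ)). Let H_1,…,H_N be finite-dimensional complex Hilbert spaces and for each i let A_{0,i}, A_{1,i} be self-adjoint unitary operators on H_i. Suppose that for each r ∈ {0,…,2^N−1} a unit vector |ψ^r⟩ ∈ H_1⊗⋯⊗H_N is given which satisfies, with the r-rotated observables Â^{(r)}: (i) ⟨ψ^r|P^0_{Â^{(r)}_{0,i}}|ψ^r⟩ = ⟨ψ^r|P^0_{Â^{(r)}_{0,i}} P^0_{Â^{(r)}_{0,j}}|ψ^r⟩ = cos²θ for all i,j ∈ {1,…,N−1}; (ii) ⟨ψ^r|∏_{i=1}^{N−2} P^{a_i}_{Â^{(r)}_{1,i}}|ψ^r⟩ = 2^{−(N−2)} for all (a_1,…,a_{N−2}) ∈ {0,1}^{N−2}; (iii) ⟨ψ^r|(∏_{i=1}^{N−2} P^{a_i}_{Â^{(r)}_{1,i}})·(α Â^{(r)}_{0,N−1} + Â^{(r)}_{0,N−1}Â^{(r)}_{0,N} + Â^{(r)}_{0,N−1}Â^{(r)}_{1,N} + (−1)^{a_1+⋯+a_{N−2}}(Â^{(r)}_{1,N−1}Â^{(r)}_{0,N}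 − Â^{(r)}_{1,N−1}Â^{(r)}_{1,N}))|ψ^r⟩ = √(8+2α²)·2^{−(N−2)} for all (a_1,…,a_{N−2}) ∈ {0,1}^{N−2}. Then there exist linear isometries V_i : H_i → H_i ⊗ ℂ² (i = 1,…,N), independent of r, and for each r a unit vector |junk_r⟩ ∈ H_1⊗⋯⊗H_N, such that under the canonical reordering of tensor factors (V_1⊗⋯⊗V_N)|ψ^r⟩ = |junk_r⟩ ⊗ |GHZ^r_θ⟩ for every r ∈ {0,…,2^N−1}. -/

import Mathlib

open scoped BigOperators
open Matrix

noncomputable section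

/-- The projector `P^a_D = (I + (-1)^a D)/2`. -/
def projP {n : Type*} [Fintype n] [DecidableEq n] (a : Fin 2) (D : Matrix n n ℂ) :
    Matrix n n ℂ :=
  (2 : ℂ)⁻¹ • (1 + ((-1 : ℂ) ^ a.val) • D)

/-- The operator on `H_1 ⊗ ⋯ ⊗ H_N` acting as `M` on the `i`-th tensor factor and as the
identity elsewhere. -/
def siteOp {N : ℕ} {d : Fin N → ℕ} (i : Fin N) (M : Matrix (Fin (d i)) (Fin (d i)) ℂ) :
    Matrix ((j : Fin N) → Fin (d j)) ((j : Fin N) → Fin (d j)) ℂ :=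
  fun x y => M (x i) (y i) * ∏ j ∈ Finset.univ.erase i, (if x j = y j then (1 : ℂ) else 0)

/-- The operator on `H_1 ⊗ ⋯ ⊗ H_N` acting as `F i` on the tensor factors `i ∈ S` and as
the identity elsewhere. -/
def multiOp {N : ℕ} {d : Fin N → ℕ} (S : Finset (Fin N))
    (F : (i : Fin N) → Matrix (Fin (d i)) (Fin (d i)) ℂ) :
    Matrix ((j : Fin N) → Fin (d j)) ((j : Fin N) → Fin (d j)) ℂ :=
  fun x y => (∏ i ∈ S, F i (x i) (y i)) * ∏ j ∈ Sᶜ, (if x j = y j then (1 : ℂ) else 0)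

/-- The tilted CHSH Bell operator on the last two sites with sign `ε` on the
`A_1`-terms. -/
def tiltedW {N : ℕ} {d : Fin N → ℕ} (hN : 2 ≤ N) (α : ℝ)
    (A : Fin 2 → (i : Fin N) → Matrix (Fin (d i)) (Fin (d i)) ℂ) (ε : ℂ) :
    Matrix ((j : Fin N) → Fin (d j)) ((j : Fin N) → Fin (d j)) ℂ :=
  (α : ℂ) • siteOp (⟨N - 2, by omega⟩ : Fin N) (A 0 ⟨N - 2, by omega⟩) +
  siteOp (⟨N - 2, by omega⟩ : Fin N) (A 0 ⟨N - 2, by omega⟩) *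
    siteOp (⟨N - 1, by omega⟩ : Fin N) (A 0 ⟨N - 1, by omega⟩) +
  siteOp (⟨N - 2, by omega⟩ : Fin N) (A 0 ⟨N - 2, by omega⟩) *
    siteOp (⟨N - 1, by omega⟩ : Fin N) (A 1 ⟨N - 1, by omega⟩) +
  ε • (siteOp (⟨N - 2, by omega⟩ : Fin N) (A 1 ⟨N - 2, by omega⟩) *
      siteOp (⟨N - 1, by omega⟩ : Fin N) (A 0 ⟨N - 1, by omega⟩) -
    siteOp (⟨N - 2, by omega⟩ : Fin N) (A 1 ⟨N - 2, by omega⟩) *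
      siteOp (⟨N - 1, by omega⟩ : Fin N) (A 1 ⟨N - 1, by omega⟩))

/-- The binary digits `k_1 … k_N` of `r` (most significant first): `r = Σ_i k_i 2^{N-i}`. -/
def bits (N r : ℕ) : Fin N → Fin 2 :=
  fun i => ⟨r / 2 ^ (N - 1 - (i : ℕ)) % 2, Nat.mod_lt _ (by norm_num)⟩

/-- `δ ∈ {0,1}^N`: zero if `Σ k_i` is even; otherwise `δ_j = 1` exactly at the smallest
index `j` with `k_j = 1`. -/
def deltaFn {N : ℕ} (k : Fin N → Fin 2) : Fin N → Fin 2 :=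
  if Even (∑ i, (k i).val) then fun _ => 0
  else fun i => if k i = 1 ∧ ∀ j, j < i → k j = 0 then 1 else 0

/-- The `r`-rotated observables `Â^{(r)}` obtained from the `A_{a,i}` and the digit
string `k` of `r`. -/
def rotObs {N : ℕ} {d : Fin N → ℕ}
    (A : Fin 2 → (i : Fin N) → Matrix (Fin (d i)) (Fin (d i)) ℂ)
    (k : Fin N → Fin 2) : Fin 2 → (i : Fin N) → Matrix (Fin (d i)) (Fin (d i)) ℂ :=
  fun a i =>
    if (i : ℕ) < N - 1 then
      (if a = 0 then ((-1 : ℂ) ^ (k i).val) • A 0 i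
       else ((-1 : ℂ) ^ (deltaFn k i).val) • A 1 i)
    else
      (if k i = deltaFn k i then ((-1 : ℂ) ^ (k i).val) • A a i
       else ((-1 : ℂ) ^ (k i).val) • A (1 - a) i)

/-- The tilted GHZ state with digit string `k`. -/
def ghzVec (N : ℕ) (θ : ℝ) (k : Fin N → Fin 2) : (Fin N → Fin 2) → ℂ :=
  fun x =>
    (if x = k then ((-1 : ℂ) ^ (∑ i, (k i).val)) * (Real.cos θ : ℂ) else 0) +
    (if x = (fun i => 1 - k i) then (Real.sin θ : ℂ) else 0)

/-- `(V_1 ⊗ ⋯ ⊗ V_N)` applied to a vector of `H_1 ⊗ ⋯ ⊗ H_N`, with the output tensor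
factors canonically reordered. -/
def tensorApply {N : ℕ} {d : Fin N → ℕ}
    (V : (i : Fin N) → Matrix (Fin (d i) × Fin 2) (Fin (d i)) ℂ)
    (ψ : ((i : Fin N) → Fin (d i)) → ℂ) :
    (((i : Fin N) → Fin (d i)) × (Fin N → Fin 2)) → ℂ :=
  fun p => ∑ y, (∏ i, V i (p.1 i, p.2 i) (y i)) * ψ y


/-! ### Positivity helper -/

theorem ghz_quad {n : Type*} [Fintype n] (L : Matrix n n ℂ) (φ : n → ℂ) :
    star φ ⬝ᵥ (Lᴴ * L).mulVec φ = star (L.mulVec φ) ⬝ᵥ L.mulVec φ := by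
  rw [← Matrix.mulVec_mulVec, Matrix.star_mulVec, Matrix.dotProduct_mulVec]

open scoped ComplexOrder in
theorem ghz_quad_nonneg {n : Type*} [Fintype n] (L : Matrix n n ℂ) (φ : n → ℂ) :
    0 ≤ star φ ⬝ᵥ (Lᴴ * L).mulVec φ := by
  rw [ghz_quad]; exact dotProduct_star_self_nonneg _

open scoped ComplexOrder in
theorem ghz_quad_zero {n : Type*} [Fintype n] (L : Matrix n n ℂ) (φ : n → ℂ)
    (h : star φ ⬝ᵥ (Lᴴ * L).mulVec φ = 0) : L.mulVec φ = 0 := by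
  rw [ghz_quad] at h; exact dotProduct_star_self_eq_zero.1 h

/-! ### Tilted CHSH -/

theorem ghz_sos {R : Type*} [Ring R] [Algebra ℂ R] (Z X zb xb : R) (c s : ℂ)
    (hZ : Z * Z = 1) (hX : X * X = 1) (h1 : zb * Z = Z * zb) (h2 : xb * Z = Z * xb)
    (h3 : zb * X = X * zb) (h4 : xb * X = X * xb) (h5 : zb * xb = - (xb * zb))
    (h6 : zb * zb = (1 + s ^ 2) • (1 : R) - (s ^ 2) • (xb * xb)) (hc : c ^ 2 = 1 - s ^ 2) :
    (4 : ℂ) • ((2 : ℂ) • (1 : R) - c • Z - Z * zb - s • (X * xb)) =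
      ((1 - Z * zb) - c • (Z - zb)) * ((1 - Z * zb) - c • (Z - zb)) +
      (((Z - zb) + c • (1 - c • Z - s • (X * xb))) * ((Z - zb) + c • (1 - c • Z - s • (X * xb))) +
      ((c • (Z - zb) + (1 - c • Z - s • (X * xb))) * (c • (Z - zb) + (1 - c • Z - s • (X * xb))) +
      (s • (s • X + c • (Z * xb) - xb)) * (s • (s • X + c • (Z * xb) - xb)))) := by
  have a1 : ∀ t, Z * (Z * t) = t := fun t => by rw [← mul_assoc, hZ, one_mul]
  have a2 : ∀ t, X * (X * t) = t := fun t => by rw [← mul_assoc, hX, one_mul]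
  have b1 : ∀ t, zb * (Z * t) = Z * (zb * t) := fun t => by rw [← mul_assoc, h1, mul_assoc]
  have b2 : ∀ t, xb * (Z * t) = Z * (xb * t) := fun t => by rw [← mul_assoc, h2, mul_assoc]
  have b3 : ∀ t, zb * (X * t) = X * (zb * t) := fun t => by rw [← mul_assoc, h3, mul_assoc]
  have b4 : ∀ t, xb * (X * t) = X * (xb * t) := fun t => by rw [← mul_assoc, h4, mul_assoc]
  simp only [sub_mul, mul_sub, add_mul, mul_add, smul_mul_assoc, mul_smul_comm, mul_assoc,
    one_mul, mul_one, smul_sub, smul_add, smul_smul, hZ, hX, a1, a2, b1, b2, b3, b4, h1, h2, h4,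
    h5, h6, smul_neg, mul_neg]
  match_scalars <;> grind

open scoped ComplexOrder in
theorem ghz_chsh {n : Type*} [Fintype n] [DecidableEq n] (Z X zb xb : Matrix n n ℂ) (c s : ℝ)
    (eZ : Zᴴ = Z) (eX : Xᴴ = X) (ez : zbᴴ = zb) (ex : xbᴴ = xb)
    (hZ : Z * Z = 1) (hX : X * X = 1) (h1 : zb * Z = Z * zb) (h2 : xb * Z = Z * xb)
    (h3 : zb * X = X * zb) (h4 : xb * X = X * xb) (h5 : zb * xb = - (xb * zb))
    (h6 : zb * zb = (1 + (s : ℂ) ^ 2) • (1 : Matrix n n ℂ) - ((s : ℂ) ^ 2) • (xb * xb))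
    (hc : c ^ 2 = 1 - s ^ 2) (hs : s ≠ 0) (φ : n → ℂ)
    (hφ : star φ ⬝ᵥ ((2 : ℂ) • (1 : Matrix n n ℂ) - (c : ℂ) • Z - Z * zb -
      (s : ℂ) • (X * xb)).mulVec φ = 0) :
    zb.mulVec φ = Z.mulVec φ ∧
    ((s : ℂ) • (xb * (1 - Z))).mulVec φ = ((1 - c : ℂ) • (X * (1 + Z))).mulVec φ := by
  have hc' : (c : ℂ) ^ 2 = 1 - (s : ℂ) ^ 2 := by exact_mod_cast hc
  have hs' : (s : ℂ) ≠ 0 := by exact_mod_cast hs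
  have key := ghz_sos Z X zb xb (c : ℂ) (s : ℂ) hZ hX h1 h2 h3 h4 h5 h6 hc'
  set L1 := ((1 - Z * zb) - (c : ℂ) • (Z - zb)) with hL1
  set L2 := ((Z - zb) + (c : ℂ) • (1 - (c : ℂ) • Z - (s : ℂ) • (X * xb))) with hL2
  set L3 := ((c : ℂ) • (Z - zb) + (1 - (c : ℂ) • Z - (s : ℂ) • (X * xb))) with hL3
  set L4 := ((s : ℂ) • ((s : ℂ) • X + (c : ℂ) • (Z * xb) - xb)) with hL4
  have e1 : L1ᴴ = L1 := by
    simp [hL1, conjTranspose_sub, conjTranspose_smul, conjTranspose_mul, eZ, ez, h1]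
  have e2 : L2ᴴ = L2 := by
    simp [hL2, conjTranspose_sub, conjTranspose_smul, conjTranspose_mul, eZ, ez, eX, ex, h4]
  have e3 : L3ᴴ = L3 := by
    simp [hL3, conjTranspose_sub, conjTranspose_smul, conjTranspose_mul, eZ, ez, eX, ex, h4]
  have e4 : L4ᴴ = L4 := by
    simp [hL4, conjTranspose_sub, conjTranspose_smul, conjTranspose_mul, eZ, eX, ex, h2]
  have n1 := ghz_quad_nonneg L1 φ
  have n2 := ghz_quad_nonneg L2 φ
  have n3 := ghz_quad_nonneg L3 φ
  have n4 := ghz_quad_nonneg L4 φ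
  have tot : star φ ⬝ᵥ (L1ᴴ * L1).mulVec φ + (star φ ⬝ᵥ (L2ᴴ * L2).mulVec φ +
      (star φ ⬝ᵥ (L3ᴴ * L3).mulVec φ + star φ ⬝ᵥ (L4ᴴ * L4).mulVec φ)) = 0 := by
    rw [e1, e2, e3, e4, ← dotProduct_add, ← dotProduct_add, ← dotProduct_add, ← add_mulVec,
      ← add_mulVec, ← add_mulVec, ← key, smul_mulVec, dotProduct_smul, hφ, smul_zero]
  rw [add_eq_zero_iff_of_nonneg n1 (add_nonneg n2 (add_nonneg n3 n4)),
    add_eq_zero_iff_of_nonneg n2 (add_nonneg n3 n4), add_eq_zero_iff_of_nonneg n3 n4] at tot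
  have z2 := ghz_quad_zero _ _ tot.2.1
  have z3 := ghz_quad_zero _ _ tot.2.2.1
  have m1 : (Z - zb) = ((s : ℂ) ^ 2)⁻¹ • (L2 - (c : ℂ) • L3) := by
    rw [hL2, hL3]
    match_scalars <;> field_simp <;> grind
  have m3 : (1 - (c : ℂ) • Z - (s : ℂ) • (X * xb)) = L3 - (c : ℂ) • (Z - zb) := by
    rw [hL3]; abel
  have r1 : (Z - zb).mulVec φ = 0 := by
    rw [m1, smul_mulVec, sub_mulVec, smul_mulVec, z2, z3]; simp
  have r3 : (1 - (c : ℂ) • Z - (s : ℂ) • (X * xb)).mulVec φ = 0 := by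
    rw [m3, sub_mulVec, smul_mulVec, z3, r1]; simp
  refine ⟨by rw [sub_mulVec] at r1; exact (sub_eq_zero.1 r1).symm, ?_⟩
  -- s xb (1-Z) - (1-c) X (1+Z) = combination
  have fin : (s : ℂ) • (xb * (1 - Z)) - (1 - c : ℂ) • (X * (1 + Z)) =
      (- X - zb * X) * (1 - (c : ℂ) • Z - (s : ℂ) • (X * xb)) +
        (- X + (c : ℂ) • (X * Z) - (s : ℂ) • xb) * (Z - zb) := by
    have a1 : ∀ t, Z * (Z * t) = t := fun t => by rw [← mul_assoc, hZ, one_mul]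
    have a2 : ∀ t, X * (X * t) = t := fun t => by rw [← mul_assoc, hX, one_mul]
    have b3 : ∀ t, zb * (X * t) = X * (zb * t) := fun t => by rw [← mul_assoc, h3, mul_assoc]
    simp only [sub_mul, mul_sub, add_mul, mul_add, smul_mul_assoc, mul_smul_comm, mul_assoc,
      mul_one, smul_sub, smul_add, hZ, a2, b3, h1, h2, h3,
      h5, smul_neg, mul_neg, neg_mul]
    match_scalars <;> grind
  rw [← sub_eq_zero, ← sub_mulVec, fin, add_mulVec, ← mulVec_mulVec, ← mulVec_mulVec, r1, r3]
  simp

/-! ### Regularisation at the last site -/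

theorem ghz_kerproj {m : Type*} [Fintype m] [DecidableEq m] (C : Matrix m m ℂ) (hC : Cᴴ = C) :
    ∃ Q D : Matrix m m ℂ, Qᴴ = Q ∧ Q * Q = Q ∧ 1 - Q = D * C ∧ C * Q = 0 ∧
      ∀ T : Matrix m m ℂ, C * T = T * C → Q * T = T * Q := by
  have hsa : IsSelfAdjoint C := hC
  have hfin : (spectrum ℝ C).Finite := Matrix.finite_real_spectrum
  have hcont : ∀ f : ℝ → ℝ, ContinuousOn f (spectrum ℝ C) := fun f => hfin.continuousOn f
  refine ⟨cfc (fun x : ℝ => if x = 0 then (1 : ℝ) else 0) C, cfc (fun x : ℝ => x⁻¹) C,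
    ?_, ?_, ?_, ?_, ?_⟩
  · exact cfc_predicate (p := IsSelfAdjoint) (fun x : ℝ => if x = 0 then (1 : ℝ) else 0) C
  · rw [← cfc_mul _ _ C (hcont _) (hcont _)]
    congr 1; ext x; split_ifs <;> simp
  · have h1 : cfc (fun x : ℝ => x⁻¹) C * C = cfc (fun x : ℝ => x⁻¹ * x) C := by
      rw [cfc_mul _ _ C (hcont _) (hcont _), cfc_id' ℝ C]
    rw [sub_eq_iff_eq_add, h1, ← cfc_add _ _ _ (hcont _) (hcont _), ← cfc_one ℝ C]
    congr 1; ext x; by_cases h : x = 0 <;> simp [h]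
  · conv_lhs => 
      arg 1
      rw [← cfc_id' ℝ C]
    rw [← cfc_mul _ _ C (hcont _) (hcont _), ← cfc_zero ℝ C]
    congr 1; ext x; by_cases h : x = 0 <;> simp [h]
  · intro T hT
    exact (hsa.commute_cfc (show Commute C T from hT) _)

theorem ghz_reg {m : Type*} [Fintype m] [DecidableEq m] (z x : Matrix m m ℂ) (s : ℝ)
    (ez : zᴴ = z) (ex : xᴴ = x) (h5 : z * x = - (x * z)) (hs : s ≠ 0)
    (h6 : z * z = (1 + (s : ℂ) ^ 2) • (1 : Matrix m m ℂ) - ((s : ℂ) ^ 2) • (x * x)) :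
    ∃ Z X D E : Matrix m m ℂ, Zᴴ = Z ∧ Xᴴ = X ∧ Z * Z = 1 ∧ X * X = 1 ∧
      Z = z + D * (z * z - 1) ∧ X = x + E * (z * z - 1) := by
  have hs' : (s : ℂ) ≠ 0 := by exact_mod_cast hs
  obtain ⟨Q, D, eQ, hQ, hD, hCQ, hcomm⟩ := ghz_kerproj (z * z - 1) (by simp [ez])
  have hz : Q * z = z * Q := hcomm z (by noncomm_ring)
  have hzzx : z * z * x = x * (z * z) := by
    rw [mul_assoc, h5, mul_neg, ← mul_assoc, h5, neg_mul, neg_neg, mul_assoc]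
  have hx : Q * x = x * Q := hcomm x (by rw [sub_mul, mul_sub, hzzx]; simp)
  have zzQ : z * z * Q = Q := by
    rw [sub_mul, one_mul, sub_eq_zero] at hCQ; exact hCQ
  have xx : x * x = ((s : ℂ) ^ 2)⁻¹ • ((1 + (s : ℂ) ^ 2) • (1 : Matrix m m ℂ) - z * z) := by
    rw [h6]; match_scalars <;> field_simp; ring
  have xxQ : x * x * Q = Q := by
    rw [xx, smul_mul_assoc, sub_mul, zzQ]; simp only [smul_mul_assoc, one_mul]
    match_scalars; field_simp; ring
  have aux : ∀ t : Matrix m m ℂ, Q * t = t * Q → t * t * Q = Q →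
      (t * Q + (1 - Q)) * (t * Q + (1 - Q)) = 1 := by
    intro t h1 h2
    have e1 : t * Q * (t * Q) = Q := by
      rw [mul_assoc, ← mul_assoc Q, h1, mul_assoc t Q, hQ, ← mul_assoc, h2]
    have e2 : t * Q * (1 - Q) = 0 := by rw [mul_sub, mul_one, mul_assoc, hQ, sub_self]
    have e3 : (1 - Q) * (t * Q) = 0 := by
      rw [sub_mul, one_mul, ← mul_assoc, h1, mul_assoc, hQ, sub_self]
    have e4 : (1 - Q) * (1 - Q) = 1 - Q := by rw [mul_sub, mul_one, sub_mul, one_mul, hQ, sub_self, sub_zero]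
    rw [add_mul, mul_add, mul_add, e1, e2, e3, e4]; abel
  refine ⟨z * Q + (1 - Q), x * Q + (1 - Q), (1 - z) * D, (1 - x) * D, ?_, ?_, aux z hz zzQ,
    aux x hx xxQ, ?_, ?_⟩
  · simp [eQ, ez, hz]
  · simp [eQ, ex, hx]
  · rw [mul_assoc, ← hD]; noncomm_ring
  · rw [mul_assoc, ← hD]; noncomm_ring

/-! ### Tensor products of operators -/

section
variable {N : ℕ} {d : Fin N → ℕ}

/-- tensor product of local operators -/
def ghzPi (G : (i : Fin N) → Matrix (Fin (d i)) (Fin (d i)) ℂ) :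
    Matrix ((j : Fin N) → Fin (d j)) ((j : Fin N) → Fin (d j)) ℂ :=
  fun x y => ∏ i, G i (x i) (y i)

theorem ghzPi_mul (G H : (i : Fin N) → Matrix (Fin (d i)) (Fin (d i)) ℂ) :
    ghzPi G * ghzPi H = ghzPi (G * H) := by
  ext x y
  simp only [ghzPi, Matrix.mul_apply, Pi.mul_apply, ← Finset.prod_mul_distrib]
  rw [Finset.prod_univ_sum]
  simp

theorem ghzPi_one : ghzPi (1 : (i : Fin N) → Matrix (Fin (d i)) (Fin (d i)) ℂ) = 1 := by
  ext x y
  simp only [ghzPi, Pi.one_apply, Matrix.one_apply, Finset.prod_ite_zero]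
  simp [funext_iff]

theorem ghzPi_conj (G : (i : Fin N) → Matrix (Fin (d i)) (Fin (d i)) ℂ) :
    (ghzPi G)ᴴ = ghzPi (fun i => (G i)ᴴ) := by
  ext x y
  simp [ghzPi, Matrix.conjTranspose_apply]

theorem ghzPi_smul (c : Fin N → ℂ) (G : (i : Fin N) → Matrix (Fin (d i)) (Fin (d i)) ℂ) :
    ghzPi (fun i => c i • G i) = (∏ i, c i) • ghzPi G := by
  ext x y
  simp [ghzPi, Finset.prod_mul_distrib]

theorem ghzPi_sum (F : (i : Fin N) → Fin 2 → Matrix (Fin (d i)) (Fin (d i)) ℂ) :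
    ∑ a : Fin N → Fin 2, ghzPi (fun i => F i (a i)) = ghzPi (fun i => ∑ b, F i b) := by
  ext x y
  simp only [ghzPi, Matrix.sum_apply]
  rw [Finset.prod_univ_sum]
  simp

theorem siteOp_eq (i : Fin N) (M : Matrix (Fin (d i)) (Fin (d i)) ℂ) :
    siteOp i M = ghzPi (Pi.mulSingle i M) := by
  ext x y
  simp only [siteOp, ghzPi]
  rw [← Finset.mul_prod_erase Finset.univ _ (Finset.mem_univ i)]
  congr 1
  · simp
  · refine Finset.prod_congr rfl fun j hj => ?_
    rw [Pi.mulSingle_eq_of_ne (Finset.ne_of_mem_erase hj), Matrix.one_apply]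

theorem multiOp_eq (S : Finset (Fin N)) (F : (i : Fin N) → Matrix (Fin (d i)) (Fin (d i)) ℂ) :
    multiOp S F = ghzPi (fun i => if i ∈ S then F i else 1) := by
  ext x y
  simp only [multiOp, ghzPi]
  rw [← Finset.prod_mul_prod_compl S]
  congr 1
  · exact Finset.prod_congr rfl fun j hj => by simp [hj]
  · refine Finset.prod_congr rfl fun j hj => ?_
    rw [if_neg (Finset.mem_compl.1 hj), Matrix.one_apply]

theorem siteOp_mul (i : Fin N) (M M' : Matrix (Fin (d i)) (Fin (d i)) ℂ) :
    siteOp i M * siteOp i M' = siteOp i (M * M') := by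
  rw [siteOp_eq, siteOp_eq, siteOp_eq, ghzPi_mul, Pi.mulSingle_mul]

theorem siteOp_one (i : Fin N) : siteOp i (1 : Matrix (Fin (d i)) (Fin (d i)) ℂ) = 1 := by
  rw [siteOp_eq, Pi.mulSingle_one, ghzPi_one]

theorem siteOp_add (i : Fin N) (M M' : Matrix (Fin (d i)) (Fin (d i)) ℂ) :
    siteOp i (M + M') = siteOp i M + siteOp i M' := by
  ext x y; simp [siteOp, add_mul]

theorem siteOp_sub (i : Fin N) (M M' : Matrix (Fin (d i)) (Fin (d i)) ℂ) :
    siteOp i (M - M') = siteOp i M - siteOp i M' := by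
  ext x y; simp [siteOp, sub_mul]

theorem siteOp_smul (i : Fin N) (c : ℂ) (M : Matrix (Fin (d i)) (Fin (d i)) ℂ) :
    siteOp i (c • M) = c • siteOp i M := by
  ext x y; simp [siteOp, mul_assoc]

theorem siteOp_conj (i : Fin N) (M : Matrix (Fin (d i)) (Fin (d i)) ℂ) :
    (siteOp i M)ᴴ = siteOp i Mᴴ := by
  ext x y
  simp [siteOp, Matrix.conjTranspose_apply, apply_ite, eq_comm]

theorem siteOp_comm {i j : Fin N} (hij : i ≠ j) (M : Matrix (Fin (d i)) (Fin (d i)) ℂ)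
    (M' : Matrix (Fin (d j)) (Fin (d j)) ℂ) :
    siteOp i M * siteOp j M' = siteOp j M' * siteOp i M := by
  rw [siteOp_eq, siteOp_eq, ghzPi_mul, ghzPi_mul]
  congr 1
  exact (Pi.mulSingle_commute (f := fun i => Matrix (Fin (d i)) (Fin (d i)) ℂ) hij M M').eq

theorem ghzPi_siteOp (G : (i : Fin N) → Matrix (Fin (d i)) (Fin (d i)) ℂ) (i : Fin N)
    (M : Matrix (Fin (d i)) (Fin (d i)) ℂ) :
    ghzPi G * siteOp i M = ghzPi (Function.update G i (G i * M)) := by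
  rw [siteOp_eq, ghzPi_mul]
  congr 1
  ext1 j
  by_cases h : j = i
  · subst h; simp
  · simp [h]

theorem siteOp_ghzPi (G : (i : Fin N) → Matrix (Fin (d i)) (Fin (d i)) ℂ) (i : Fin N)
    (M : Matrix (Fin (d i)) (Fin (d i)) ℂ) :
    siteOp i M * ghzPi G = ghzPi (Function.update G i (M * G i)) := by
  rw [siteOp_eq, ghzPi_mul]
  congr 1
  ext1 j
  by_cases h : j = i
  · subst h; simp
  · simp [h]

theorem ghzPi_comm_site (G : (i : Fin N) → Matrix (Fin (d i)) (Fin (d i)) ℂ) (i : Fin N)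
    (M : Matrix (Fin (d i)) (Fin (d i)) ℂ) (h : G i = 1) :
    siteOp i M * ghzPi G = ghzPi G * siteOp i M := by
  rw [ghzPi_siteOp, siteOp_ghzPi, h, one_mul, mul_one]

theorem ghzPi_fix (G : (i : Fin N) → Matrix (Fin (d i)) (Fin (d i)) ℂ)
    (φ : ((j : Fin N) → Fin (d j)) → ℂ) (h : ∀ i, (siteOp i (G i)).mulVec φ = φ) :
    (ghzPi G).mulVec φ = φ := by
  have key : ∀ S : Finset (Fin N),
      (ghzPi (fun i => if i ∈ S then G i else 1)).mulVec φ = φ := by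
    intro S
    induction S using Finset.induction_on with
    | empty =>
      have := ghzPi_one (d := d)
      simp only [Finset.notMem_empty, if_false]
      erw [this]; simp
    | insert i S hi ih =>
      have : ghzPi (fun j => if j ∈ insert i S then G j else 1) =
          siteOp i (G i) * ghzPi (fun j => if j ∈ S then G j else 1) := by
        rw [siteOp_ghzPi]
        congr 1
        ext1 j
        by_cases hj : j = i
        · subst hj; simp [hi]
        · simp [hj]
      rw [this, ← mulVec_mulVec, ih, h]
  simpa using key Finset.univ

theorem tensorApply_eq (F : (i : Fin N) → Fin 2 → Matrix (Fin (d i)) (Fin (d i)) ℂ)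
    (ψ : ((i : Fin N) → Fin (d i)) → ℂ) :
    tensorApply (fun i => (fun p y => F i p.2 p.1 y : Matrix (Fin (d i) × Fin 2) (Fin (d i)) ℂ)) ψ
      = fun p => (ghzPi (fun i => F i (p.2 i))).mulVec ψ p.1 := by
  ext p
  simp [tensorApply, ghzPi, Matrix.mulVec, dotProduct]

end

/-! ### Projector facts -/

section
variable {m : Type*} [Fintype m] [DecidableEq m]

theorem ghzP_conj (b : Fin 2) (Z : Matrix m m ℂ) (eZ : Zᴴ = Z) : (projP b Z)ᴴ = projP b Z := by
  simp [projP, conjTranspose_smul, eZ]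

theorem ghzP_idem (b : Fin 2) (Z : Matrix m m ℂ) (hZ : Z * Z = 1) :
    projP b Z * projP b Z = projP b Z := by
  have hb : ((-1 : ℂ) ^ b.val) * ((-1 : ℂ) ^ b.val) = 1 := by
    rw [← pow_add, ← two_mul]; simp
  simp only [projP, smul_mul_assoc, mul_smul_comm, add_mul, mul_add, hZ, mul_one, one_mul, smul_smul]
  match_scalars <;> grind

theorem ghzP_compl (b : Fin 2) (Z : Matrix m m ℂ) : projP (1 - b) Z = 1 - projP b Z := by
  fin_cases b <;> simp [projP] <;> match_scalars <;> norm_num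

theorem ghzP_orth (b : Fin 2) (Z : Matrix m m ℂ) (hZ : Z * Z = 1) :
    projP (1 - b) Z * projP b Z = 0 := by
  rw [ghzP_compl, sub_mul, one_mul, ghzP_idem b Z hZ, sub_self]

theorem ghzP_sum (Z : Matrix m m ℂ) : ∑ b, projP b Z = 1 := by
  simp [projP, Fin.sum_univ_two]; match_scalars <;> norm_num

theorem ghzP_signsum (Z : Matrix m m ℂ) : ∑ b : Fin 2, ((-1 : ℂ) ^ b.val) • projP b Z = Z := by
  simp [projP, Fin.sum_univ_two]; match_scalars <;> norm_num

theorem ghzP_rot (b : Fin 2) (Z : Matrix m m ℂ) :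
    projP 0 (((-1 : ℂ) ^ b.val) • Z) = projP b Z := by
  simp [projP]

end

theorem ghz_delta {N : ℕ} (k : Fin N → Fin 2) :
    ∏ i, ((-1 : ℂ) ^ (deltaFn k i).val) = (-1 : ℂ) ^ (∑ i, (k i).val) := by
  unfold deltaFn
  split_ifs with h
  · simp [h.neg_one_pow]
  · have hodd : Odd (∑ i, (k i).val) := Nat.not_even_iff_odd.1 h
    rw [hodd.neg_one_pow]
    have hex : ∃ i, k i = 1 := by
      by_contra hcon
      push Not at hcon
      apply h
      have : ∀ i, k i = 0 := fun i => by have := hcon i; omega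
      simp [this]
    obtain ⟨i, hi, hmin⟩ := WellFounded.has_min (wellFounded_lt (α := Fin N)) {i | k i = 1} hex
    rw [Finset.prod_eq_single i]
    · have : k i = 1 ∧ ∀ j, j < i → k j = 0 := ⟨hi, fun j hj => by
        have : ¬ k j = 1 := fun h => hmin j h hj
        omega⟩
      simp only [if_pos this]; simp
    · intro j _ hj
      have : ¬ (k j = 1 ∧ ∀ l, l < j → k l = 0) := by
        rintro ⟨h1, h2⟩
        rcases lt_or_gt_of_ne hj with h | h
        · exact hmin j h1 h
        · have := h2 i h
          rw [show k i = 1 from hi] at this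
          exact absurd this (by decide)
      simp only [if_neg this]; simp
    · simp

/-! ### The swap isometry -/

section
variable {N : ℕ} {d : Fin N → ℕ}

/-- local Kraus-like blocks of the swap isometry -/
def ghzBlk (Z X : (i : Fin N) → Matrix (Fin (d i)) (Fin (d i)) ℂ) (i : Fin N) (b : Fin 2) :
    Matrix (Fin (d i)) (Fin (d i)) ℂ := (if b = 0 then 1 else X i) * projP b (Z i)

/-- the swap isometry -/
def ghzIso (Z X : (i : Fin N) → Matrix (Fin (d i)) (Fin (d i)) ℂ) (i : Fin N) :
    Matrix (Fin (d i) × Fin 2) (Fin (d i)) ℂ := fun p y => ghzBlk Z X i p.2 p.1 y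

theorem ghzIso_isometry (Z X : (i : Fin N) → Matrix (Fin (d i)) (Fin (d i)) ℂ)
    (eZ : ∀ i, (Z i)ᴴ = Z i) (hZ : ∀ i, Z i * Z i = 1) (eX : ∀ i, (X i)ᴴ = X i)
    (hX : ∀ i, X i * X i = 1) (i : Fin N) : (ghzIso Z X i)ᴴ * ghzIso Z X i = 1 := by
  have h : (ghzIso Z X i)ᴴ * ghzIso Z X i = ∑ b, (ghzBlk Z X i b)ᴴ * ghzBlk Z X i b := by
    ext x y
    simp only [Matrix.mul_apply, Matrix.sum_apply, conjTranspose_apply, ghzIso]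
    rw [Fintype.sum_prod_type, Finset.sum_comm]
  have h2 : ∀ b, (ghzBlk Z X i b)ᴴ * ghzBlk Z X i b = projP b (Z i) := by
    intro b
    have hx : (if b = 0 then 1 else X i)ᴴ * (if b = 0 then 1 else X i) = 1 := by
      split_ifs <;> simp [eX, hX]
    rw [ghzBlk, conjTranspose_mul, ghzP_conj _ _ (eZ i), mul_assoc, ← mul_assoc _ _ (projP b (Z i)),
      hx, one_mul, ghzP_idem _ _ (hZ i)]
  rw [h, Finset.sum_congr rfl fun b _ => h2 b, ghzP_sum]

theorem ghzPP (Z : (i : Fin N) → Matrix (Fin (d i)) (Fin (d i)) ℂ) (hZ : ∀ i, Z i * Z i = 1)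
    (hN : 0 < N) (k : Fin N → Fin 2) (ψ φ : ((i : Fin N) → Fin (d i)) → ℂ)
    (h : ∀ i, (siteOp i (projP (k i) (Z i))).mulVec ψ = φ) :
    (ghzPi (fun i => projP (k i) (Z i))).mulVec ψ = φ := by
  have h1 := ghzPi_siteOp (fun i => projP (k i) (Z i)) ⟨0, hN⟩ (projP (k ⟨0, hN⟩) (Z ⟨0, hN⟩))
  simp only [ghzP_idem _ _ (hZ _)] at h1
  rw [Function.update_eq_self_iff.2 rfl] at h1
  rw [← h1, ← mulVec_mulVec, h]
  apply ghzPi_fix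
  intro i
  rw [← h i, mulVec_mulVec, siteOp_mul, ghzP_idem _ _ (hZ _)]

theorem ghzPP_zero (Z : (i : Fin N) → Matrix (Fin (d i)) (Fin (d i)) ℂ) (hZ : ∀ i, Z i * Z i = 1)
    (k a : Fin N → Fin 2) (ψ φ : ((i : Fin N) → Fin (d i)) → ℂ)
    (h : ∀ i, (siteOp i (projP (k i) (Z i))).mulVec ψ = φ)
    (h1 : a ≠ k) (h2 : a ≠ fun i => 1 - k i) :
    (ghzPi (fun i => projP (a i) (Z i))).mulVec ψ = 0 := by
  have ⟨j, hj⟩ : ∃ j, a j ≠ k j := by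
    by_contra hc; push Not at hc; exact h1 (funext hc)
  have ⟨i, hi⟩ : ∃ i, a i = k i := by
    by_contra hc; push Not at hc
    exact h2 (funext fun i => by have := hc i; omega)
  have hj' : a j = 1 - k j := by omega
  have key : ∀ i, ghzPi (fun i => projP (a i) (Z i)) * siteOp i (projP (a i) (Z i)) =
      ghzPi (fun i => projP (a i) (Z i)) := by
    intro i
    have h1 := ghzPi_siteOp (fun i => projP (a i) (Z i)) i (projP (a i) (Z i))
    simp only [ghzP_idem _ _ (hZ _)] at h1
    rwa [Function.update_eq_self_iff.2 rfl] at h1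
  rw [← key i, ← mulVec_mulVec, hi, h i, ← key j, ← mulVec_mulVec, hj', ← h j,
    mulVec_mulVec ψ (siteOp j _), siteOp_mul, ghzP_orth _ _ (hZ _)]
  have : siteOp j (0 : Matrix (Fin (d j)) (Fin (d j)) ℂ) = 0 := by
    ext x y; simp [siteOp]
  rw [this]; simp

theorem ghz_swap (hN : 0 < N) (Z X : (i : Fin N) → Matrix (Fin (d i)) (Fin (d i)) ℂ)
    (hZ : ∀ i, Z i * Z i = 1) (eX : ∀ i, (X i)ᴴ = X i)
    (hX : ∀ i, X i * X i = 1) (θ : ℝ) (hC : Real.cos θ ≠ 0) (k : Fin N → Fin 2)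
    (ψ φ : ((i : Fin N) → Fin (d i)) → ℂ)
    (h : ∀ i, (siteOp i (projP (k i) (Z i))).mulVec ψ = φ)
    (hφ : star φ ⬝ᵥ φ = (Real.cos θ : ℂ) ^ 2)
    (hx : (Real.cos θ : ℂ) • (ghzPi X).mulVec (ψ - φ) =
      ((-1 : ℂ) ^ (∑ i, (k i).val) * (Real.sin θ : ℂ)) • φ) :
    ∃ junk : ((i : Fin N) → Fin (d i)) → ℂ,
        star junk ⬝ᵥ junk = 1 ∧
        tensorApply (ghzIso Z X) ψ = fun p => junk p.1 * ghzVec N θ k p.2 := by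
  have hC' : (Real.cos θ : ℂ) ≠ 0 := by exact_mod_cast hC
  set sg : ℂ := (-1 : ℂ) ^ (∑ i, (k i).val) with hsg
  have sg2 : sg * sg = 1 := by rw [hsg, ← pow_add, ← two_mul]; simp
  have sgs : star sg = sg := by rw [hsg]; simp
  set XX : (Fin N → Fin 2) → (i : Fin N) → Matrix (Fin (d i)) (Fin (d i)) ℂ :=
    fun a i => if a i = 0 then 1 else X i with hXX
  have h' : ∀ i, (siteOp i (projP (1 - k i) (Z i))).mulVec ψ = ψ - φ := by
    intro i
    rw [ghzP_compl, siteOp_sub, siteOp_one, sub_mulVec, h i, one_mulVec]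
  have hx' : (ghzPi X).mulVec (ψ - φ) = (sg * (Real.sin θ : ℂ) / (Real.cos θ : ℂ)) • φ := by
    rw [div_eq_inv_mul, mul_smul, ← hx, smul_smul, inv_mul_cancel₀ hC', one_smul]
  have hunit : (ghzPi (XX k))ᴴ * ghzPi (XX k) = 1 := by
    rw [ghzPi_conj, ghzPi_mul, ← ghzPi_one]
    congr 1; ext1 i
    simp only [hXX, Pi.mul_apply, Pi.one_apply]
    split_ifs <;> simp [eX, hX]
  have hkk : ghzPi (XX fun i => 1 - k i) = ghzPi (XX k) * ghzPi X := by
    rw [ghzPi_mul]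
    congr 1; ext1 i
    simp only [hXX, Pi.mul_apply]
    rcases (show k i = 0 ∨ k i = 1 by omega) with e | e <;> simp [e, hX]
  refine ⟨(sg / (Real.cos θ : ℂ)) • (ghzPi (XX k)).mulVec φ, ?_, ?_⟩
  · rw [star_smul, smul_dotProduct, dotProduct_smul, ← ghz_quad, hunit, one_mulVec, hφ]
    simp only [star_div₀, sgs, smul_eq_mul]
    have : star (Real.cos θ : ℂ) = (Real.cos θ : ℂ) := Complex.conj_ofReal _
    rw [this]
    field_simp
    linear_combination sg2
  · have hT := tensorApply_eq (ghzBlk Z X) ψ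
    unfold ghzIso
    rw [hT]
    ext p
    obtain ⟨x, a⟩ := p
    have hfac : ghzPi (fun i => ghzBlk Z X i (a i)) =
        ghzPi (XX a) * ghzPi (fun i => projP (a i) (Z i)) := by
      rw [ghzPi_mul]; rfl
    simp only [hfac, ← mulVec_mulVec, ghzVec, ← hsg]
    have hne : k ≠ fun i => 1 - k i := by
      intro e
      have := congrFun e ⟨0, hN⟩
      omega
    by_cases e1 : a = k
    · subst e1
      rw [ghzPP Z hZ hN _ ψ φ h, if_pos rfl, if_neg hne]
      simp only [Pi.smul_apply, smul_eq_mul, add_zero]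
      field_simp
      linear_combination - (ghzPi (XX a) *ᵥ φ) x * sg2
    by_cases e2 : a = fun i => 1 - k i
    · subst e2
      rw [ghzPP Z hZ hN _ ψ _ h', if_neg e1, if_pos rfl, hkk, ← mulVec_mulVec, hx', mulVec_smul]
      simp only [Pi.smul_apply, smul_eq_mul, zero_add]
      ring
    · rw [ghzPP_zero Z hZ k a ψ φ h e1 e2, if_neg e1, if_neg e2]
      simp

end

/-! ### From the correlations to operator relations on the state -/

section
variable {N : ℕ} {d : Fin N → ℕ}

set_option maxHeartbeats 2000000 in
theorem ghz_relations (hN : 3 ≤ N) (α β c s q : ℝ) (hs : s ≠ 0) (hc : c ^ 2 = 1 - s ^ 2)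
    (hq : 0 < q) (hq2 : q ^ 2 = 1 + s ^ 2) (hα : α = 2 * c / q) (hβ : β = 4 / q)
    (A : Fin 2 → (i : Fin N) → Matrix (Fin (d i)) (Fin (d i)) ℂ)
    (eA : ∀ a i, (A a i)ᴴ = A a i) (hA : ∀ a i, A a i * A a i = 1)
    (ψ : ((i : Fin N) → Fin (d i)) → ℂ) (n2 n1 : Fin N) (hn2 : n2 = ⟨N - 2, by omega⟩)
    (hn1 : n1 = ⟨N - 1, by omega⟩) (S : Finset (Fin N))
    (hS : S = Finset.univ.filter fun i : Fin N => (i : ℕ) < N - 2)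
    (h2 : ∀ (a : Fin N → Fin 2), star ψ ⬝ᵥ
        (multiOp S (fun i => projP (a i) (A 1 i))).mulVec ψ = ((2 : ℂ) ^ (N - 2))⁻¹)
    (h3 : ∀ (a : Fin N → Fin 2), star ψ ⬝ᵥ
        ((multiOp S (fun i => projP (a i) (A 1 i)) * tiltedW (by omega) α A
              ((-1 : ℂ) ^ (∑ i ∈ S, (a i).val)))).mulVec ψ = (β : ℂ) * ((2 : ℂ) ^ (N - 2))⁻¹) :
    (siteOp n1 ((q / 2 : ℂ) • (A 0 n1 + A 1 n1))).mulVec ψ = (siteOp n2 (A 0 n2)).mulVec ψ ∧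
    ((s : ℂ) • (siteOp n1 ((q / (2 * s) : ℂ) • (A 0 n1 - A 1 n1)) *
        (1 - siteOp n2 (A 0 n2)))).mulVec ψ =
      ((1 - c : ℂ) • (siteOp n2 (A 1 n2) * (1 + siteOp n2 (A 0 n2)) *
        ghzPi (fun i => if i ∈ S then A 1 i else 1))).mulVec ψ := by
  have hs' : (s : ℂ) ≠ 0 := by exact_mod_cast hs
  have hq' : (q : ℂ) ≠ 0 := by exact_mod_cast hq.ne'
  have hq2' : (q : ℂ) ^ 2 = 1 + (s : ℂ) ^ 2 := by exact_mod_cast hq2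
  have hne : n1 ≠ n2 := by rw [hn1, hn2]; intro h; simp only [Fin.mk.injEq] at h; omega
  have hn1S : n1 ∉ S := by rw [hS, hn1]; simp; omega
  have hn2S : n2 ∉ S := by rw [hS, hn2]; simp
  set z : Matrix (Fin (d n1)) (Fin (d n1)) ℂ := (q / 2 : ℂ) • (A 0 n1 + A 1 n1) with hz
  set x : Matrix (Fin (d n1)) (Fin (d n1)) ℂ := (q / (2 * s) : ℂ) • (A 0 n1 - A 1 n1) with hx
  have hzx : z * x = - (x * z) := by
    simp only [hz, hx, smul_mul_assoc, mul_smul_comm, add_mul, mul_sub, sub_mul, mul_add, hA]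
    match_scalars <;> ring
  have hzz : z * z = (1 + (s : ℂ) ^ 2) • (1 : Matrix (Fin (d n1)) (Fin (d n1)) ℂ)
      - ((s : ℂ) ^ 2) • (x * x) := by
    simp only [hz, hx, smul_mul_assoc, mul_smul_comm, add_mul, mul_sub, sub_mul, mul_add, hA]
    match_scalars <;> field_simp <;> grind
  have ez : zᴴ = z := by simp [hz, eA]
  have ex : xᴴ = x := by simp [hx, eA]
  set Z := siteOp n2 (A 0 n2) with hZdef
  set X := siteOp n2 (A 1 n2) with hXdef
  set Pa : (Fin N → Fin 2) → _ := fun a => multiOp S (fun i => projP (a i) (A 1 i)) with hPa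
  have pa_conj : ∀ a, (Pa a)ᴴ = Pa a := by
    intro a
    simp only [hPa, multiOp_eq, ghzPi_conj]
    congr 1; ext1 i
    split_ifs
    · exact ghzP_conj _ _ (eA _ _)
    · simp
  have pa_idem : ∀ a, Pa a * Pa a = Pa a := by
    intro a
    simp only [hPa, multiOp_eq, ghzPi_mul]
    congr 1; ext1 i
    simp only [Pi.mul_apply]
    split_ifs
    · exact ghzP_idem _ _ (hA _ _)
    · simp
  have pa_c1 : ∀ a M, siteOp n1 M * Pa a = Pa a * siteOp n1 M := by
    intro a M
    simp only [hPa, multiOp_eq]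
    exact ghzPi_comm_site _ _ _ (by simp [hn1S])
  have pa_c2 : ∀ a M, siteOp n2 M * Pa a = Pa a * siteOp n2 M := by
    intro a M
    simp only [hPa, multiOp_eq]
    exact ghzPi_comm_site _ _ _ (by simp [hn2S])
  have main : ∀ a, (siteOp n1 z).mulVec ((Pa a).mulVec ψ) = Z.mulVec ((Pa a).mulVec ψ) ∧
    ((s : ℂ) • (siteOp n1 x * (1 - Z))).mulVec ((Pa a).mulVec ψ) =
      ((1 - c : ℂ) • ((((-1 : ℂ) ^ (∑ i ∈ S, (a i).val)) • X) * (1 + Z))).mulVec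
        ((Pa a).mulVec ψ) := by
    intro a
    set ε : ℂ := (-1 : ℂ) ^ (∑ i ∈ S, (a i).val) with hε
    have ε2 : ε * ε = 1 := by rw [hε, ← pow_add, ← two_mul]; simp
    have εs : star ε = ε := by rw [hε]; simp
    refine ghz_chsh Z (ε • X) (siteOp n1 z) (siteOp n1 x) c s ?_ ?_ ?_ ?_ ?_ ?_ ?_ ?_ ?_ ?_ ?_ ?_
      hc hs _ ?_
    · rw [hZdef, siteOp_conj, eA]
    · rw [conjTranspose_smul, hXdef, siteOp_conj, eA, εs]
    · rw [siteOp_conj, ez]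
    · rw [siteOp_conj, ex]
    · rw [hZdef, siteOp_mul, hA, siteOp_one]
    · rw [hXdef, smul_mul_smul_comm, ε2, siteOp_mul, hA, siteOp_one, one_smul]
    · exact siteOp_comm hne _ _
    · exact siteOp_comm hne _ _
    · rw [mul_smul_comm, smul_mul_assoc, siteOp_comm hne]
    · rw [mul_smul_comm, smul_mul_assoc, siteOp_comm hne]
    · rw [siteOp_mul, siteOp_mul, hzx, ← neg_one_smul ℂ (x * z), siteOp_smul, neg_one_smul]
    · rw [siteOp_mul, siteOp_mul, hzz, siteOp_sub, siteOp_smul, siteOp_smul, siteOp_one]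
    · have hM : ((2 : ℂ) • (1 : Matrix _ _ ℂ) - (c : ℂ) • Z - Z * siteOp n1 z -
          (s : ℂ) • (ε • X * siteOp n1 x)) =
          (2 : ℂ) • 1 - (q / 2 : ℂ) • tiltedW (by omega) α A ε := by
        unfold tiltedW
        subst hn1 hn2
        rw [← hZdef, ← hXdef, hz, hx]
        simp only [siteOp_smul, siteOp_add, siteOp_sub, mul_smul_comm, smul_mul_assoc, mul_add,
          mul_sub, hα]
        push_cast
        match_scalars <;> field_simp
      have hcomm : Pa a * ((2 : ℂ) • (1 : Matrix _ _ ℂ) - (c : ℂ) • Z - Z * siteOp n1 z -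
          (s : ℂ) • (ε • X * siteOp n1 x)) = ((2 : ℂ) • (1 : Matrix _ _ ℂ) - (c : ℂ) • Z -
          Z * siteOp n1 z - (s : ℂ) • (ε • X * siteOp n1 x)) * Pa a := by
        have e1 : ∀ M M', siteOp n2 M * siteOp n1 M' * Pa a = Pa a * (siteOp n2 M * siteOp n1 M') := by
          intro M M'
          rw [mul_assoc, pa_c1, ← mul_assoc, pa_c2, mul_assoc]
        simp only [hZdef, hXdef, mul_sub, sub_mul, mul_smul_comm, smul_mul_assoc, e1, pa_c2,
          mul_one, one_mul]
      rw [star_mulVec, ← dotProduct_mulVec, mulVec_mulVec, mulVec_mulVec, pa_conj, hcomm,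
        mul_assoc _ (Pa a) (Pa a), pa_idem, ← hcomm, hM, mul_sub, mul_smul_comm, mul_smul_comm, mul_one, sub_mulVec,
        smul_mulVec, smul_mulVec, dotProduct_sub, dotProduct_smul, dotProduct_smul, h2 a, h3 a, hβ]
      push_cast
      simp only [smul_eq_mul]
      field_simp
      ring
  -- sum over `a`
  set F : (i : Fin N) → Fin 2 → Matrix (Fin (d i)) (Fin (d i)) ℂ := fun i b =>
    if i ∈ S then projP b (A 1 i) else if b = 0 then 1 else 0 with hF
  have hFa : ∀ a, ghzPi (fun i => F i (a i)) = Pa a ∨ ghzPi (fun i => F i (a i)) = 0 := by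
    intro a
    by_cases h : ∃ j, j ∉ S ∧ a j ≠ 0
    · right
      obtain ⟨j, hj, hja⟩ := h
      ext u v
      simp only [ghzPi]
      refine Finset.prod_eq_zero (Finset.mem_univ j) ?_
      simp [hF, hj, hja]
    · left
      push Not at h
      simp only [hPa, multiOp_eq]
      congr 1; ext1 i
      by_cases hi : i ∈ S
      · simp [hF, hi]
      · simp [hF, hi, h i hi]
  have sum1 : ∑ a : Fin N → Fin 2, ghzPi (fun i => F i (a i)) = 1 := by
    rw [ghzPi_sum, ← ghzPi_one]
    congr 1; ext1 i
    by_cases hi : i ∈ S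
    · simp only [hF, hi, if_true, Pi.one_apply]; exact ghzP_sum _
    · simp [hF, hi]
  have sum2 : ∑ a : Fin N → Fin 2, ((-1 : ℂ) ^ (∑ i ∈ S, (a i).val)) • ghzPi (fun i => F i (a i)) =
      ghzPi (fun i => if i ∈ S then A 1 i else 1) := by
    have : ∀ a : Fin N → Fin 2, ((-1 : ℂ) ^ (∑ i ∈ S, (a i).val)) • ghzPi (fun i => F i (a i)) =
        ghzPi (fun i => (fun (i : Fin N) (b : Fin 2) =>
          (if i ∈ S then (-1 : ℂ) ^ b.val else 1) • F i b) i (a i)) := by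
      intro a
      simp only
      rw [ghzPi_smul (fun i => if i ∈ S then (-1 : ℂ) ^ (a i).val else 1) (fun i => F i (a i))]
      congr 1
      rw [← Finset.prod_pow_eq_pow_sum, Finset.prod_ite_mem, Finset.univ_inter]
    rw [Finset.sum_congr rfl fun a _ => this a,
      ghzPi_sum (fun i b => (if i ∈ S then (-1 : ℂ) ^ b.val else 1) • F i b)]
    congr 1; ext1 i
    by_cases hi : i ∈ S
    · simp only [hF, hi, if_true]; exact ghzP_signsum _
    · simp [hF, hi]
  have main' : ∀ a : Fin N → Fin 2, (siteOp n1 z * ghzPi (fun i => F i (a i))).mulVec ψ =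
        (Z * ghzPi (fun i => F i (a i))).mulVec ψ ∧
    (((s : ℂ) • (siteOp n1 x * (1 - Z))) * ghzPi (fun i => F i (a i))).mulVec ψ =
      (((1 - c : ℂ) • (X * (1 + Z))) * (((-1 : ℂ) ^ (∑ i ∈ S, (a i).val)) •
        ghzPi (fun i => F i (a i)))).mulVec ψ := by
    intro a
    rcases hFa a with h | h
    · rw [h]
      obtain ⟨m1, m2⟩ := main a
      rw [mulVec_mulVec, mulVec_mulVec] at m1 m2
      refine ⟨m1, m2.trans ?_⟩
      congr 1
      simp only [smul_mul_assoc, mul_smul_comm]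
      exact smul_comm _ _ _
    · rw [h]; simp
  constructor
  · have e : ∑ a : Fin N → Fin 2, (siteOp n1 z * ghzPi (fun i => F i (a i))).mulVec ψ =
        ∑ a : Fin N → Fin 2, (Z * ghzPi (fun i => F i (a i))).mulVec ψ :=
      Finset.sum_congr rfl fun a _ => (main' a).1
    rw [← sum_mulVec, ← sum_mulVec, ← Finset.mul_sum, ← Finset.mul_sum, sum1] at e
    simpa using e
  · have e := Finset.sum_congr (rfl : (Finset.univ : Finset (Fin N → Fin 2)) = Finset.univ)
      fun a _ => (main' a).2
    rw [← sum_mulVec, ← sum_mulVec, ← Finset.mul_sum, ← Finset.mul_sum, sum1, sum2, mul_one] at e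
    rw [e, smul_mul_assoc]

end

/-- Lemma 2: a single family of local isometries simultaneously
self-tests all the tilted GHZ states `|GHZ^r_θ⟩`. -/
theorem stmt_1 (N : ℕ) (hN : 3 ≤ N) (θ α : ℝ) (hθ : θ ∈ Set.Ioc 0 (Real.pi / 4))
    (hα : α = 2 * Real.cos (2 * θ) / Real.sqrt (1 + Real.sin (2 * θ) ^ 2))
    (d : Fin N → ℕ)
    (A : Fin 2 → (i : Fin N) → Matrix (Fin (d i)) (Fin (d i)) ℂ)
    (hAherm : ∀ a i, (A a i).IsHermitian) (hAunit : ∀ a i, A a i * A a i = 1)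
    (ψ : Fin (2 ^ N) → ((i : Fin N) → Fin (d i)) → ℂ)
    (hψ : ∀ r, star (ψ r) ⬝ᵥ ψ r = 1)
    (h1 : ∀ (r : Fin (2 ^ N)) (i j : Fin N), (i : ℕ) < N - 1 → (j : ℕ) < N - 1 →
      star (ψ r) ⬝ᵥ
          (siteOp i (projP 0 (rotObs A (bits N r) 0 i))).mulVec (ψ r) =
        ((Real.cos θ) ^ 2 : ℂ) ∧
      star (ψ r) ⬝ᵥ
          ((siteOp i (projP 0 (rotObs A (bits N r) 0 i)) *
            siteOp j (projP 0 (rotObs A (bits N r) 0 j)))).mulVec (ψ r) =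
        ((Real.cos θ) ^ 2 : ℂ))
    (h2 : ∀ (r : Fin (2 ^ N)) (a : Fin N → Fin 2),
      star (ψ r) ⬝ᵥ
          (multiOp (Finset.univ.filter fun i : Fin N => (i : ℕ) < N - 2)
            (fun i => projP (a i) (rotObs A (bits N r) 1 i))).mulVec (ψ r) =
        ((2 : ℂ) ^ (N - 2))⁻¹)
    (h3 : ∀ (r : Fin (2 ^ N)) (a : Fin N → Fin 2),
      star (ψ r) ⬝ᵥ
          ((multiOp (Finset.univ.filter fun i : Fin N => (i : ℕ) < N - 2)
              (fun i => projP (a i) (rotObs A (bits N r) 1 i)) *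
            tiltedW (by omega) α (rotObs A (bits N r))
              ((-1 : ℂ) ^
                (∑ i ∈ Finset.univ.filter (fun i : Fin N => (i : ℕ) < N - 2),
                  (a i).val)))).mulVec (ψ r) =
        (Real.sqrt (8 + 2 * α ^ 2) : ℂ) * ((2 : ℂ) ^ (N - 2))⁻¹) :
    ∃ V : (i : Fin N) → Matrix (Fin (d i) × Fin 2) (Fin (d i)) ℂ,
      (∀ i, (V i)ᴴ * V i = 1) ∧
      ∀ r : Fin (2 ^ N), ∃ junk : ((i : Fin N) → Fin (d i)) → ℂ,
        star junk ⬝ᵥ junk = 1 ∧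
        tensorApply V (ψ r) = fun p => junk p.1 * ghzVec N θ (bits N r) p.2 := by
  classical
  obtain ⟨hθ0, hθ1⟩ := hθ
  have hpi := Real.pi_pos
  set s := Real.sin (2 * θ) with hs_def
  set c := Real.cos (2 * θ) with hc_def
  set q := Real.sqrt (1 + s ^ 2) with hq_def
  have hs : 0 < s := Real.sin_pos_of_pos_of_lt_pi (by linarith) (by linarith)
  have hsin : 0 < Real.sin θ := Real.sin_pos_of_pos_of_lt_pi (by linarith) (by linarith)
  have hcos : 0 < Real.cos θ := Real.cos_pos_of_mem_Ioo ⟨by linarith, by linarith⟩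
  have hc : c ^ 2 = 1 - s ^ 2 := by
    have := Real.sin_sq_add_cos_sq (2 * θ); linarith
  have hq : 0 < q := Real.sqrt_pos.2 (by positivity)
  have hq2 : q ^ 2 = 1 + s ^ 2 := Real.sq_sqrt (by positivity)
  have hβ : Real.sqrt (8 + 2 * α ^ 2) = 4 / q := by
    rw [Real.sqrt_eq_iff_mul_self_eq (by positivity) (by positivity), hα]
    field_simp
    rw [hq2, hc]; ring
  have hs2 : s = 2 * Real.sin θ * Real.cos θ := Real.sin_two_mul θ
  have hc2 : 1 - c = 2 * Real.sin θ ^ 2 := by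
    have := Real.cos_two_mul θ
    have := Real.sin_sq_add_cos_sq θ
    linarith
  have hs' : (s : ℂ) ≠ 0 := by exact_mod_cast hs.ne'
  have hq2' : (q : ℂ) ^ 2 = 1 + (s : ℂ) ^ 2 := by exact_mod_cast hq2
  obtain ⟨n1, hn1⟩ : ∃ n1 : Fin N, n1 = ⟨N - 1, by omega⟩ := ⟨_, rfl⟩
  obtain ⟨n2, hn2⟩ : ∃ n2 : Fin N, n2 = ⟨N - 2, by omega⟩ := ⟨_, rfl⟩
  have hne : n1 ≠ n2 := by rw [hn1, hn2]; intro h; simp only [Fin.mk.injEq] at h; omega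
  have hlt : ∀ i : Fin N, i ≠ n1 → (i : ℕ) < N - 1 := by
    intro i hi
    have := i.2
    have : (i : ℕ) ≠ N - 1 := fun h => hi (by rw [hn1]; exact Fin.ext h)
    omega
  have hn1lt : ¬ ((n1 : ℕ) < N - 1) := by rw [hn1]; simp
  obtain ⟨z, hz⟩ : ∃ z : Matrix (Fin (d n1)) (Fin (d n1)) ℂ,
      z = (q / 2 : ℂ) • (A 0 n1 + A 1 n1) := ⟨_, rfl⟩
  obtain ⟨x, hx⟩ : ∃ x : Matrix (Fin (d n1)) (Fin (d n1)) ℂ,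
      x = (q / (2 * s) : ℂ) • (A 0 n1 - A 1 n1) := ⟨_, rfl⟩
  have eA : ∀ a i, (A a i)ᴴ = A a i := fun a i => hAherm a i
  obtain ⟨Zr, Xr, D, E, eZr, eXr, hZr, hXr, hZD, hXE⟩ := ghz_reg z x s
    (by simp [hz, eA]) (by simp [hx, eA])
    (by
      simp only [hz, hx, smul_mul_assoc, mul_smul_comm, add_mul, mul_sub, sub_mul, mul_add, hAunit]
      match_scalars <;> ring) hs.ne'
    (by
      simp only [hz, hx, smul_mul_assoc, mul_smul_comm, add_mul, mul_sub, sub_mul, mul_add, hAunit]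
      match_scalars <;> field_simp <;> grind)
  obtain ⟨Zs, hZs⟩ : ∃ Zs, Zs = Function.update (A 0) n1 Zr := ⟨_, rfl⟩
  obtain ⟨Xs, hXs⟩ : ∃ Xs, Xs = Function.update (A 1) n1 Xr := ⟨_, rfl⟩
  have Zs1 : Zs n1 = Zr := by simp [hZs]
  have Xs1 : Xs n1 = Xr := by simp [hXs]
  have Zsi : ∀ i, i ≠ n1 → Zs i = A 0 i := fun i hi => by simp [hZs, hi]
  have Xsi : ∀ i, i ≠ n1 → Xs i = A 1 i := fun i hi => by simp [hXs, hi]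
  have eZ : ∀ i, (Zs i)ᴴ = Zs i := fun i => by
    by_cases hi : i = n1
    · subst hi; rw [Zs1, eZr]
    · rw [Zsi i hi, eA]
  have hZ : ∀ i, Zs i * Zs i = 1 := fun i => by
    by_cases hi : i = n1
    · subst hi; rw [Zs1, hZr]
    · rw [Zsi i hi, hAunit]
  have eX : ∀ i, (Xs i)ᴴ = Xs i := fun i => by
    by_cases hi : i = n1
    · subst hi; rw [Xs1, eXr]
    · rw [Xsi i hi, eA]
  have hX : ∀ i, Xs i * Xs i = 1 := fun i => by
    by_cases hi : i = n1
    · subst hi; rw [Xs1, hXr]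
    · rw [Xsi i hi, hAunit]
  refine ⟨ghzIso Zs Xs, ghzIso_isometry Zs Xs eZ hZ eX hX, fun r => ?_⟩
  obtain ⟨k, hk⟩ : ∃ k, k = bits N r := ⟨_, rfl⟩
  obtain ⟨δ, hδ⟩ : ∃ δ, δ = deltaFn k := ⟨_, rfl⟩
  obtain ⟨R, hR⟩ : ∃ R, R = rotObs A k := ⟨_, rfl⟩
  have h1r := h1 r
  have h2r := h2 r
  have h3r := h3 r
  obtain ⟨v, hv⟩ : ∃ v, v = ψ r := ⟨_, rfl⟩
  rw [← hk] at h1r h2r h3r ⊢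
  rw [← hv] at h1r h2r h3r ⊢
  rw [← hR] at h1r h2r h3r
  have sq1 : ∀ j : ℕ, ((-1 : ℂ) ^ j) * ((-1 : ℂ) ^ j) = 1 := fun j => by
    rw [← pow_add, ← two_mul]; simp
  have R0 : ∀ i, i ≠ n1 → R 0 i = ((-1 : ℂ) ^ (k i).val) • A 0 i := fun i hi => by
    simp [hR, rotObs, hlt i hi]
  have R1 : ∀ i, i ≠ n1 → R 1 i = ((-1 : ℂ) ^ (δ i).val) • A 1 i := fun i hi => by
    simp [hR, rotObs, hlt i hi, hδ]
  have Rp : R 0 n1 + R 1 n1 = ((-1 : ℂ) ^ (k n1).val) • (A 0 n1 + A 1 n1) := by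
    simp only [hR, rotObs, hn1lt, if_false]
    split_ifs <;> simp [add_comm]
  have Rm : R 0 n1 - R 1 n1 = ((-1 : ℂ) ^ (δ n1).val) • (A 0 n1 - A 1 n1) := by
    simp only [hR, rotObs, hn1lt, if_false, ← hδ]
    by_cases e : k n1 = δ n1
    · simp [e, smul_sub]
    · have e2 : ((-1 : ℂ) ^ (k n1).val) = - ((-1 : ℂ) ^ (δ n1).val) := by
        rcases (show (k n1 = 0 ∧ δ n1 = 1) ∨ (k n1 = 1 ∧ δ n1 = 0) by omega) with ⟨a, b⟩ | ⟨a, b⟩ <;>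
          simp [a, b]
      simp only [if_neg e, e2]
      simp [smul_sub, add_comm]
      try abel
  have Rform : ∀ a i, ∃ (j : ℕ) (b : Fin 2), R a i = ((-1 : ℂ) ^ j) • A b i := by
    intro a i
    simp only [hR, rotObs]
    split_ifs <;> exact ⟨_, _, rfl⟩
  have eR : ∀ a i, (R a i)ᴴ = R a i := by
    intro a i
    obtain ⟨j, b, e⟩ := Rform a i
    rw [e]; simp [eA]
  have hRR : ∀ a i, R a i * R a i = 1 := by
    intro a i
    obtain ⟨j, b, e⟩ := Rform a i
    rw [e, smul_mul_smul_comm, sq1, hAunit, one_smul]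
  obtain ⟨rel1, rel2⟩ := ghz_relations hN α (Real.sqrt (8 + 2 * α ^ 2)) c s q hs.ne' hc hq hq2 hα hβ
    R eR hRR v n2 n1 hn2 hn1 _ rfl h2r h3r
  rw [Rp, smul_comm, ← hz, siteOp_smul] at rel1
  rw [Rm, smul_comm, ← hx, siteOp_smul] at rel2
  set σ : ℂ := (-1 : ℂ) ^ (k n1).val with hσ
  set τ : ℂ := (-1 : ℂ) ^ (δ n1).val with hτ
  have σ2 : σ * σ = 1 := sq1 _
  have τ2 : τ * τ = 1 := sq1 _
  set Zh := siteOp n2 (R 0 n2) with hZh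
  have Zh2 : Zh * Zh = 1 := by rw [hZh, siteOp_mul, hRR, siteOp_one]
  have rel1' : (siteOp n1 z).mulVec v = σ • Zh.mulVec v := by
    rw [← rel1, smul_mulVec, smul_smul, σ2, one_smul]
  have hker : (siteOp n1 (z * z - 1)).mulVec v = 0 := by
    rw [siteOp_sub, sub_mulVec, ← siteOp_mul, ← mulVec_mulVec, rel1', mulVec_smul, mulVec_mulVec,
      hZh, siteOp_comm hne, ← hZh, ← mulVec_mulVec, rel1', mulVec_smul, smul_smul, σ2, one_smul,
      mulVec_mulVec, Zh2, siteOp_one, sub_self]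
  have hker2 : (siteOp n1 (z * z - 1)).mulVec (Zh.mulVec v) = 0 := by
    rw [mulVec_mulVec, hZh, siteOp_comm hne, ← mulVec_mulVec, hker, mulVec_zero]
  have hZrv : (siteOp n1 Zr).mulVec v = σ • Zh.mulVec v := by
    rw [hZD, siteOp_add, add_mulVec, ← siteOp_mul, ← mulVec_mulVec, hker, mulVec_zero, add_zero, rel1']
  have hXrv : ∀ w, (siteOp n1 (z * z - 1)).mulVec w = 0 →
      (siteOp n1 Xr).mulVec w = (siteOp n1 x).mulVec w := by
    intro w hw
    rw [hXE, siteOp_add, add_mulVec, ← siteOp_mul, ← mulVec_mulVec, hw, mulVec_zero, add_zero]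
  obtain ⟨φ, hφ⟩ : ∃ φ, φ = (siteOp n2 (projP 0 (R 0 n2))).mulVec v := ⟨_, rfl⟩
  have hφ' : φ = (2 : ℂ)⁻¹ • (v + Zh.mulVec v) := by
    rw [hφ, projP, siteOp_smul, siteOp_add, siteOp_smul, siteOp_one, ← hZh, smul_mulVec, add_mulVec]
    simp
  have hproj : ∀ i, (siteOp i (projP (k i) (Zs i))).mulVec v = φ := by
    intro i
    by_cases hi : i = n1
    · subst hi
      rw [Zs1, projP, siteOp_smul, siteOp_add, siteOp_smul, siteOp_one, smul_mulVec, add_mulVec,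
        smul_mulVec, hZrv, ← hσ, smul_smul, σ2, one_smul, one_mulVec, hφ']
    · rw [Zsi i hi, ← ghzP_rot, ← R0 i hi, hφ]
      obtain ⟨p1, p2⟩ := h1r i n2 (hlt i hi) (hlt n2 hne.symm)
      obtain ⟨p3, p4⟩ := h1r n2 i (hlt n2 hne.symm) (hlt i hi)
      rw [← sub_eq_zero, ← sub_mulVec]
      apply ghz_quad_zero
      rw [conjTranspose_sub, siteOp_conj, siteOp_conj, ghzP_conj _ _ (eR _ _),
        ghzP_conj _ _ (eR _ _), sub_mul, mul_sub, mul_sub, siteOp_mul, siteOp_mul,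
        ghzP_idem _ _ (hRR _ _), ghzP_idem _ _ (hRR _ _), sub_mulVec, sub_mulVec, sub_mulVec,
        dotProduct_sub, dotProduct_sub, dotProduct_sub, p1, p2, p3, p4]
      ring
  refine ghz_swap (by omega) Zs Xs hZ eX hX θ hcos.ne' k v φ hproj ?_ ?_
  · rw [hφ, ← ghz_quad, siteOp_conj, ghzP_conj _ _ (eR _ _), siteOp_mul, ghzP_idem _ _ (hRR _ _)]
    exact (h1r n2 n2 (hlt n2 hne.symm) (hlt n2 hne.symm)).1
  · have hφ1 : v - φ = (2 : ℂ)⁻¹ • (v - Zh.mulVec v) := by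
      rw [hφ']; module
    have hker3 : (siteOp n1 (z * z - 1)).mulVec (v - φ) = 0 := by
      rw [hφ1, mulVec_smul, mulVec_sub, hker, hker2]; simp
    have hn2S : n2 ∉ Finset.univ.filter (fun i : Fin N => (i : ℕ) < N - 2) := by
      rw [hn2]; simp
    have hn1S : n1 ∉ Finset.univ.filter (fun i : Fin N => (i : ℕ) < N - 2) := by
      rw [hn1]; simp; omega
    obtain ⟨G, hG⟩ : ∃ G, G = Function.update (R 1) n1 1 := ⟨_, rfl⟩
    have hGeq : siteOp n2 (R 1 n2) * (1 + Zh) * ghzPi (fun i =>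
        if i ∈ Finset.univ.filter (fun i : Fin N => (i : ℕ) < N - 2) then R 1 i else 1) =
        ghzPi G * (1 + Zh) := by
      have e1 : (1 + Zh) * ghzPi (fun i =>
          if i ∈ Finset.univ.filter (fun i : Fin N => (i : ℕ) < N - 2) then R 1 i else 1) =
          ghzPi (fun i =>
          if i ∈ Finset.univ.filter (fun i : Fin N => (i : ℕ) < N - 2) then R 1 i else 1) *
          (1 + Zh) := by
        rw [add_mul, mul_add, one_mul, mul_one, hZh, ghzPi_comm_site _ _ _ (if_neg hn2S)]
      rw [mul_assoc, e1, ← mul_assoc, siteOp_ghzPi]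
      congr 2
      rw [hG]
      ext1 i
      by_cases i1 : i = n1
      · subst i1
        rw [Function.update_of_ne hne, if_neg hn1S, Function.update_self]
      · rw [Function.update_of_ne i1]
        by_cases i2 : i = n2
        · subst i2
          rw [Function.update_self, if_neg hn2S, mul_one]
        · rw [Function.update_of_ne i2, if_pos]
          have h1 := hlt i i1
          have h2 : (i : ℕ) ≠ N - 2 := fun h => i2 (by rw [hn2]; exact Fin.ext h)
          simp only [Finset.mem_filter, Finset.mem_univ, true_and]
          omega
    have hGG : ghzPi G * ghzPi G = 1 := by
      rw [ghzPi_mul, ← ghzPi_one]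
      congr 1
      ext1 i
      by_cases i1 : i = n1
      · subst i1; simp [hG]
      · simp [hG, i1, hRR]
    have hGX : ghzPi G * siteOp n1 (τ • Xr) = ((-1 : ℂ) ^ (∑ i, (k i).val)) • ghzPi Xs := by
      rw [← ghz_delta, ← hδ, ← ghzPi_smul, ghzPi_siteOp]
      congr 1
      ext1 i
      by_cases i1 : i = n1
      · subst i1; simp [hG, Xs1, ← hτ]
      · rw [Function.update_of_ne i1, hG, Function.update_of_ne i1, R1 i i1, Xsi i i1]
    rw [hGeq, smul_mulVec, smul_mulVec, ← mulVec_mulVec, ← mulVec_mulVec, sub_mulVec, add_mulVec,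
      one_mulVec, show v - Zh.mulVec v = (2 : ℂ) • (v - φ) by rw [hφ1, smul_smul]; simp,
      show v + Zh.mulVec v = (2 : ℂ) • φ by rw [hφ', smul_smul]; simp] at rel2
    rw [smul_mulVec, mulVec_smul, mulVec_smul, ← hXrv _ hker3] at rel2
    have rel3 := congrArg (fun w => (ghzPi G).mulVec w) rel2
    simp only [mulVec_smul] at rel3
    rw [mulVec_mulVec (v - φ), mulVec_mulVec φ, hGG, one_mulVec] at rel3
    rw [siteOp_smul, mul_smul_comm] at hGX
    have hGX' : ghzPi G * siteOp n1 Xr = (τ * (-1 : ℂ) ^ (∑ i, (k i).val)) • ghzPi Xs := by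
      rw [mul_smul, ← hGX, smul_smul, τ2, one_smul]
    rw [hGX', smul_mulVec] at rel3
    have hs2' : (s : ℂ) = 2 * (Real.sin θ : ℂ) * (Real.cos θ : ℂ) := by
      rw [hs2]; push_cast; ring
    have hc2' : (1 - c : ℂ) = 2 * (Real.sin θ : ℂ) ^ 2 := by
      exact_mod_cast hc2
    have hsin' : (Real.sin θ : ℂ) ≠ 0 := by exact_mod_cast hsin.ne'
    rw [hs2', hc2'] at rel3
    have sg2 := sq1 (∑ i, (k i).val)
    set sg : ℂ := (-1 : ℂ) ^ (∑ i, (k i).val) with hsg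
    set y := (ghzPi Xs).mulVec (v - φ) with hy
    ext p
    have e := congrFun rel3 p
    simp only [Pi.smul_apply, smul_eq_mul] at e ⊢
    have e' : (4 * (Real.sin θ : ℂ)) * ((Real.cos θ : ℂ) * (sg * y p)) =
        (4 * (Real.sin θ : ℂ)) * ((Real.sin θ : ℂ) * φ p) := by
      linear_combination e - 4 * (Real.sin θ : ℂ) * (Real.cos θ : ℂ) * sg * y p * τ2
    have e'' := mul_left_cancel₀ (mul_ne_zero (by norm_num) hsin') e'
    linear_combination sg * e'' - (Real.cos θ : ℂ) * y p * sg2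

end
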